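/- arXiv:1607.04529 — 2 statements merged into one kernel-verified Lean document; each statement's English description precedes it below -/
import Mathlib

section
/- Let R be a Noetherian ring, 𝔞 ⊊ R a proper ideal, and M a finite R-module with c = cd(𝔞,M). Let (0) = N₁ ∩ … ∩ Nₙ be a reduced primary decomposition of the zero submodule of M, where N_j is 𝔭_j-primary, and for 0 ≤ i ≤ c set M_i = ∩_{cd(𝔞,R/𝔭_j) > i} N_j. If cd(𝔞, ∩_{cd(𝔞,R/𝔭_j) > 0} N_j) = 0, then {M_i}_{i=0}^c is the cd-filtration of M. -/
open CategoryTheory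

noncomputable section

/-- The cohomological dimension `cd(𝔞, M)`: the supremum (in `ℕ`) of the set of
indices `i` with `H^i_𝔞(M) ≠ 0`, local cohomology being taken w.r.t. `𝔞`. -/
def cohDim {R : Type} [CommRing R] (I : Ideal R) (M : Type) [AddCommGroup M] [Module R M] : ℕ :=
  sSup {i : ℕ | Nontrivial ((localCohomology I i).obj (ModuleCat.of R M))}

/-- `M` is relative Cohen-Macaulay w.r.t. `𝔞` if there is precisely one non-vanishing
local cohomology module of `M` w.r.t. `𝔞`. -/
def IsRelCM {R : Type} [CommRing R] (I : Ideal R) (M : Type) [AddCommGroup M] [Module R M] :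
    Prop :=
  ∃ c : ℕ, ∀ i : ℕ, Nontrivial ((localCohomology I i).obj (ModuleCat.of R M)) ↔ i = c

/-- `f : K →ₗ[R] E` exhibits `E` as an injective hull of `K`:
`E` is an injective module and `f` is an essential monomorphism. -/
structure IsInjectiveHull (R : Type) [CommRing R] {K E : Type} [AddCommGroup K] [Module R K]
    [AddCommGroup E] [Module R E] (f : K →ₗ[R] E) : Prop where
  injective : Module.Injective R E
  inj : Function.Injective f
  essential : ∀ N : Submodule R E, N ≠ ⊥ → N ⊓ LinearMap.range f ≠ ⊥

/-- `F` is the cohomological dimension filtration (cd-filtration) of `M` in the range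
`0 ≤ i ≤ c`: `F i` is the largest submodule of `M` of cohomological dimension `≤ i`. -/
def IsCdFiltration {R : Type} [CommRing R] (I : Ideal R) {M : Type} [AddCommGroup M]
    [Module R M] (c : ℕ) (F : ℕ → Submodule R M) : Prop :=
  ∀ i ≤ c, cohDim I (F i) ≤ i ∧ ∀ N : Submodule R M, cohDim I N ≤ i → N ≤ F i

/-- The `i`-th factor `M_i / M_{i-1}` of a filtration `F` of `M`. -/
def filtFactor {R : Type} [CommRing R] {M : Type} [AddCommGroup M] [Module R M]
    (F : ℕ → Submodule R M) (i : ℕ) : Type :=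
  ↥(F i) ⧸ Submodule.comap (F i).subtype (F (i - 1))

instance {R : Type} [CommRing R] {M : Type} [AddCommGroup M] [Module R M]
    (F : ℕ → Submodule R M) (i : ℕ) : AddCommGroup (filtFactor F i) :=
  inferInstanceAs (AddCommGroup (↥(F i) ⧸ Submodule.comap (F i).subtype (F (i - 1))))

instance {R : Type} [CommRing R] {M : Type} [AddCommGroup M] [Module R M]
    (F : ℕ → Submodule R M) (i : ℕ) : Module R (filtFactor F i) :=
  inferInstanceAs (Module R (↥(F i) ⧸ Submodule.comap (F i).subtype (F (i - 1))))

/-- `M` is a relative Cohen-Macaulay filtered (RCMF) module w.r.t. `𝔞`: every factor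
`M_i/M_{i-1}` (`1 ≤ i ≤ c = cd(𝔞,M)`) of its cd-filtration is either zero or an
`i`-cohomological dimensional relative Cohen-Macaulay module w.r.t. `𝔞`. -/
def IsRCMF {R : Type} [CommRing R] (I : Ideal R) (M : Type) [AddCommGroup M] [Module R M] :
    Prop :=
  ∀ F : ℕ → Submodule R M, IsCdFiltration I (cohDim I M) F →
    ∀ i : ℕ, 1 ≤ i → i ≤ cohDim I M →
      Subsingleton (filtFactor F i) ∨
        (IsRelCM I (filtFactor F i) ∧ cohDim I (filtFactor F i) = i)

end

noncomputable section
open CategoryTheory Limits Opposite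
universe u
section bridge
variable {R : Type u} [CommRing R] {X X' : ModuleCat.{u} R}

def yoMap {P Q : ChainComplex (ModuleCat.{u} R) ℕ} (φ : P ⟶ Q) (Y : ModuleCat.{u} R) :
    Q.linearYonedaObj R Y ⟶ P.linearYonedaObj R Y :=
  (HomologicalComplex.unopFunctor _ _).map
    ((((linearYoneda R (ModuleCat.{u} R)).obj Y).rightOp.mapHomologicalComplex _).map φ).op

lemma yoMap_f {P Q : ChainComplex (ModuleCat.{u} R) ℕ} (φ : P ⟶ Q) (Y : ModuleCat.{u} R) (i : ℕ)
    (f : Q.X i ⟶ Y) : (yoMap φ Y).f i f = (φ.f i ≫ f : P.X i ⟶ Y) := rfl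

lemma hnat_aux {C : Type*} [Category C] {A B A' B' : C} (e : A ≅ A') (f : B ≅ B')
    (a : A' ⟶ B') (b : A ⟶ B) (h : e.hom ≫ a = b ≫ f.hom) : a ≫ f.inv = e.inv ≫ b := by
  rw [Iso.comp_inv_eq, Category.assoc, Iso.eq_inv_comp, h]

lemma homologyUnop_nat {K L : HomologicalComplex (ModuleCat.{u} R)ᵒᵖ (ComplexShape.down ℕ)} (ψ : K ⟶ L) (i : ℕ) :
    (HomologicalComplex.homologyMap ψ i).unop ≫ (K.homologyUnop i).inv =
     (L.homologyUnop i).inv ≫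
      HomologicalComplex.homologyMap ((HomologicalComplex.unopFunctor _ _).map ψ.op) i := by
  have := HomologicalComplex.homologyOp_hom_naturality
    ((HomologicalComplex.unopFunctor _ _).map ψ.op) i
  exact hnat_aux _ _ _ _ (congrArg Quiver.Hom.unop this)

lemma isoExt_nat (g : X' ⟶ X) (P : ProjectiveResolution X) (P' : ProjectiveResolution X')
    (φ : P'.Hom P g) (n : ℕ) (Y : ModuleCat.{u} R) :
    ((Ext R (ModuleCat.{u} R) n).map g.op).app Y ≫ (P'.isoExt n Y).hom =
      (P.isoExt n Y).hom ≫ HomologicalComplex.homologyMap (yoMap φ.hom Y) n := by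
  have h := ProjectiveResolution.isoLeftDerivedObj_inv_naturality g P' P φ.hom
    (by simpa using φ.hom_f_zero_comp_π_f_zero) ((linearYoneda R (ModuleCat.{u} R)).obj Y).rightOp n
  have h2 := congrArg Quiver.Hom.unop h
  have h3 := homologyUnop_nat ((((linearYoneda R (ModuleCat.{u} R)).obj Y).rightOp.mapHomologicalComplex _).map φ.hom) n
  rw [unop_comp, unop_comp] at h2
  calc _ = (((((linearYoneda R (ModuleCat.{u} R)).obj Y).rightOp.leftDerived n).map g).unop ≫ (P'.isoLeftDerivedObj ((linearYoneda R (ModuleCat.{u} R)).obj Y).rightOp n).inv.unop) ≫ (HomologicalComplex.homologyUnop _ n).inv := (Category.assoc _ _ _).symm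
    _ = _ := by
      rw [h2]
      refine (Category.assoc _ _ _).trans ?_
      refine (congrArg (fun t => _ ≫ t) h3).trans ?_
      exact (Category.assoc _ _ _).symm

/-- class of a cocycle in `Ext` -/
lemma exists_cls (P : ProjectiveResolution X) (n : ℕ) (Y : ModuleCat.{u} R) (e : ((Ext R (ModuleCat.{u} R) n).obj (op X)).obj Y) :
   ∃ z : (P.complex.linearYonedaObj R Y).cycles n, (P.isoExt n Y).hom e = (P.complex.linearYonedaObj R Y).homologyπ n z := by
  have : Function.Surjective ((P.complex.linearYonedaObj R Y).homologyπ n) := by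
    rw [← ModuleCat.epi_iff_surjective]; infer_instance
  obtain ⟨z, hz⟩ := this ((P.isoExt n Y).hom e)
  exact ⟨z, hz.symm⟩

lemma homologyπ_zero_iff (K : CochainComplex (ModuleCat.{u} R) ℕ) (n : ℕ) (z : K.cycles (n+1)) :
   K.homologyπ (n+1) z = 0 ↔ ∃ y : K.X n, K.d n (n+1) y = K.iCycles (n+1) z := by
  have h := (ShortComplex.moduleCat_exact_iff _).1 (ShortComplex.exact_of_g_is_cokernel (.mk (K.toCycles n (n+1)) (K.homologyπ (n+1)) (by simp)) (K.homologyIsCokernel n (n+1) (by simp)))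
  have hi : Function.Injective (K.iCycles (n+1)) := by
    rw [← ModuleCat.mono_iff_injective]; infer_instance
  constructor
  · intro hz
    obtain ⟨y, hy⟩ := h z hz
    refine ⟨y, ?_⟩
    rw [← hy]
    exact congr($(K.toCycles_i n (n+1)).hom y).symm
  · rintro ⟨y, hy⟩
    have : z = K.toCycles n (n+1) y := by
      apply hi; rw [← hy]
      exact congr($(K.toCycles_i n (n+1)).hom y).symm
    rw [this]
    exact congr($(K.toCycles_comp_homologyπ n (n+1)).hom y)

/-- Correspondence between the two models of `Ext`. -/
def ExtRel {Y : ModuleCat.{u} R} {n : ℕ} (P : ProjectiveResolution X)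
    (e : ((Ext R (ModuleCat.{u} R) n).obj (op X)).obj Y) (ξ : Abelian.Ext.{u} X Y n) : Prop :=
  ∃ (z : (P.complex.linearYonedaObj R Y).cycles n) (f : P.complex.X n ⟶ Y)
    (hf : P.complex.d (n+1) n ≫ f = 0), (P.complex.linearYonedaObj R Y).iCycles n z = f ∧
    (P.isoExt n Y).hom e = (P.complex.linearYonedaObj R Y).homologyπ n z ∧
    ξ = P.extMk f (n+1) rfl hf

lemma ExtRel.exists_right {Y : ModuleCat.{u} R} {n : ℕ} (P : ProjectiveResolution X)
    (e : ((Ext R (ModuleCat.{u} R) n).obj (op X)).obj Y) : ∃ ξ, ExtRel P e ξ := by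
  obtain ⟨z, hz⟩ := exists_cls P n Y e
  refine ⟨_, z, (P.complex.linearYonedaObj R Y).iCycles n z, ?_, rfl, hz, rfl⟩
  exact congr($((P.complex.linearYonedaObj R Y).iCycles_d n (n+1)).hom z)

lemma ExtRel.exists_left {Y : ModuleCat.{u} R} {n : ℕ} (P : ProjectiveResolution X)
    (ξ : Abelian.Ext.{u} X Y n) : ∃ e, ExtRel P e ξ := by
  obtain ⟨f, hf, rfl⟩ := P.extMk_surjective ξ (n+1) rfl
  let K := P.complex.linearYonedaObj R Y
  have h := (ShortComplex.moduleCat_exact_iff _).1 (ShortComplex.exact_of_f_is_kernel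
    (.mk (K.iCycles n) (K.d n (n+1)) (by simp)) (K.cyclesIsKernel n (n+1) (by simp)))
  obtain ⟨z, hz⟩ := h (f : P.complex.X n ⟶ Y) hf
  refine ⟨(P.isoExt n Y).inv (K.homologyπ n z), z, f, hf, hz, ?_, rfl⟩
  exact congr($((P.isoExt (R := R) n Y).inv_hom_id).hom (K.homologyπ n z))

lemma ExtRel.zero_iff {Y : ModuleCat.{u} R} {n : ℕ} {P : ProjectiveResolution X}
    {e : ((Ext R (ModuleCat.{u} R) (n+1)).obj (op X)).obj Y} {ξ : Abelian.Ext.{u} X Y (n+1)}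
    (h : ExtRel P e ξ) : e = 0 ↔ ξ = 0 := by
  obtain ⟨z, f, hf, hz, he, rfl⟩ := h
  rw [P.extMk_eq_zero_iff f _ rfl hf n rfl]
  have : e = 0 ↔ (P.isoExt (n+1) Y).hom e = 0 := by
    constructor
    · rintro rfl; simp
    · intro h
      have h2 := congr($((P.isoExt (R := R) (n+1) Y).hom_inv_id).hom e)
      rw [ModuleCat.comp_apply] at h2
      rw [h] at h2
      simpa using h2.symm
  rw [this, he, homologyπ_zero_iff, hz]
  rfl

lemma ExtRel.map {Y : ModuleCat.{u} R} {n : ℕ} {P : ProjectiveResolution X}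
    {e : ((Ext R (ModuleCat.{u} R) n).obj (op X)).obj Y} {ξ : Abelian.Ext.{u} X Y n}
    (h : ExtRel P e ξ) (P' : ProjectiveResolution X') (g : X' ⟶ X) :
    ExtRel P' (((Ext R (ModuleCat.{u} R) n).map g.op).app Y e)
      ((Abelian.Ext.mk₀ g).comp ξ (zero_add n)) := by
  obtain ⟨z, f, hf, hz, he, rfl⟩ := h
  let φ : P'.Hom P g := ⟨ProjectiveResolution.lift g P' P, by
    simpa using ProjectiveResolution.lift_commutes_zero g P' P⟩
  refine ⟨HomologicalComplex.cyclesMap (yoMap φ.hom Y) n z, φ.hom.f n ≫ f,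
    by simp [← φ.hom.comm_assoc, hf], ?_, ?_, ?_⟩
  · have := congr($(HomologicalComplex.cyclesMap_i (yoMap φ.hom Y) n).hom z)
    refine this.trans ?_
    rw [ModuleCat.comp_apply, hz]
    rfl
  · have := congr($(isoExt_nat g P P' φ n Y).hom e)
    refine this.trans ?_
    rw [ModuleCat.comp_apply, he]
    exact congr($(HomologicalComplex.homologyπ_naturality (yoMap φ.hom Y) n).hom z)
  · exact ProjectiveResolution.mk₀_comp_extMk f (n+1) rfl hf φ

end bridge

section dies
variable {R : Type} [CommRing R]

/-- Restriction of an Ext class along `R/J → R/I`, for `J ≤ I`. -/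
abbrev qmap {J I : Ideal R} (h : J ≤ I) : ModuleCat.of R (R ⧸ J) ⟶ ModuleCat.of R (R ⧸ I) :=
  ModuleCat.ofHom (Submodule.mapQ J I LinearMap.id h)

def Dies (I : Ideal R) (i : ℕ) (M : ModuleCat.{0} R) : Prop :=
  ∀ (n : ℕ) (ξ : Abelian.Ext.{0} (ModuleCat.of R (R ⧸ I ^ n)) M i), ∃ (m : ℕ) (h : n ≤ m),
    (Abelian.Ext.mk₀ (qmap (Ideal.pow_le_pow_right h))).comp ξ (zero_add i) = 0

lemma dies_iff (I : Ideal R) (i : ℕ) (M : ModuleCat.{0} R) :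
    ¬ Nontrivial ((localCohomology I (i+1)).obj M) ↔ Dies I (i+1) M := by
  rw [not_nontrivial_iff_subsingleton]
  have := localCohomology.hasColimitDiagram (localCohomology.idealPowersDiagram I) (i+1)
  let F := localCohomology.diagram (localCohomology.idealPowersDiagram I) (i+1)
  let hc : IsColimit (((evaluation _ _).obj M).mapCocone (colimit.cocone F)) :=
    isColimitOfPreserves _ (colimit.isColimit F)
  change Subsingleton (((evaluation _ _).obj M).mapCocone (colimit.cocone F)).pt ↔ _
  constructor
  · intro hs n ξ
    obtain ⟨e, he⟩ := ExtRel.exists_left (projectiveResolution _) ξ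
    obtain ⟨k, f, g, hfg⟩ := Concrete.isColimit_exists_of_rep_eq (F ⋙ (evaluation _ _).obj M)
      (i := op (op n)) (j := op (op n)) hc e 0 (hs.elim _ _)
    refine ⟨k.unop.unop, f.unop.unop.down.down, ?_⟩
    rw [← (he.map (projectiveResolution _) _).zero_iff]
    refine hfg.trans (map_zero _)
  · intro hd
    refine ⟨fun x y => ?_⟩
    suffices ∀ x : (((evaluation _ _).obj M).mapCocone (colimit.cocone F)).pt, x = 0 by
      rw [this x, this y]
    intro x
    obtain ⟨j, e, rfl⟩ := Concrete.isColimit_exists_rep _ hc x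
    obtain ⟨⟨k⟩⟩ := j
    obtain ⟨ξ, hξ⟩ := ExtRel.exists_right (X := ModuleCat.of R (R ⧸ I ^ k)) (projectiveResolution _) e
    obtain ⟨m, h, hm⟩ := hd _ ξ
    replace hm := (hξ.map (projectiveResolution _) _).zero_iff.2 hm
    let w : op (op k) ⟶ op (op m) := (homOfLE h).op.op
    have := congr($((((evaluation _ _).obj M).mapCocone (colimit.cocone F)).w w).hom e)
    rw [← this, ModuleCat.comp_apply]
    refine (congrArg _ hm).trans (map_zero _)
end dies

section vanish
open Abelian
variable {R : Type} [CommRing R]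

/-- pullback of Ext classes -/
abbrev pb {X X' Y : ModuleCat.{0} R} {i : ℕ} (f : X' ⟶ X) (ξ : Abelian.Ext.{0} X Y i) :
    Abelian.Ext.{0} X' Y i := (Abelian.Ext.mk₀ f).comp ξ (zero_add i)

lemma pb_pb {X X' X'' Y : ModuleCat.{0} R} {i : ℕ} (f : X' ⟶ X) (g : X'' ⟶ X')
    (ξ : Abelian.Ext.{0} X Y i) : pb g (pb f ξ) = pb (g ≫ f) ξ := by
  simp [pb]

lemma qmap_comp {A B C : Ideal R} (h : A ≤ B) (h' : B ≤ C) :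
    qmap h ≫ qmap h' = qmap (h.trans h') := by
  ext; rfl

lemma Dies.mid {I : Ideal R} {i : ℕ} {S : ShortComplex (ModuleCat.{0} R)} (hS : S.ShortExact)
    (h1 : Dies I i S.X₁) (h3 : Dies I i S.X₃) : Dies I i S.X₂ := by
  intro n ξ
  obtain ⟨m, hm, h⟩ := h3 n (ξ.comp (Abelian.Ext.mk₀ S.g) (add_zero i))
  rw [← Ext.comp_assoc_of_third_deg_zero] at h
  obtain ⟨η, hη⟩ := Ext.covariant_sequence_exact₂ _ hS _ h
  obtain ⟨l, hl, h⟩ := h1 m η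
  refine ⟨l, hm.trans hl, ?_⟩
  rw [← qmap_comp (Ideal.pow_le_pow_right hl) (Ideal.pow_le_pow_right hm)]
  change pb _ _ = 0
  rw [← pb_pb, pb, pb, ← hη, ← Ext.comp_assoc_of_third_deg_zero, h, Ext.zero_comp]

lemma Dies.right {I : Ideal R} {i : ℕ} {S : ShortComplex (ModuleCat.{0} R)} (hS : S.ShortExact)
    (h2 : Dies I i S.X₂) (h1 : Dies I (i+1) S.X₁) : Dies I i S.X₃ := by
  intro n ξ
  obtain ⟨m, hm, h⟩ := h1 n (ξ.comp hS.extClass rfl)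
  rw [← Ext.comp_assoc _ _ _ (zero_add i) rfl (by omega)] at h
  obtain ⟨η, hη⟩ := Ext.covariant_sequence_exact₃ _ hS _ rfl h
  obtain ⟨l, hl, h⟩ := h2 m η
  refine ⟨l, hm.trans hl, ?_⟩
  rw [← qmap_comp (Ideal.pow_le_pow_right hl) (Ideal.pow_le_pow_right hm)]
  change pb _ _ = 0
  rw [← pb_pb, pb, pb, ← hη, ← Ext.comp_assoc_of_third_deg_zero, h, Ext.zero_comp]

/-- multiplication map between cyclic modules -/
abbrev mq (r : R) {A B : Ideal R} (h : ∀ a ∈ A, r * a ∈ B) :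
    ModuleCat.of R (R ⧸ A) ⟶ ModuleCat.of R (R ⧸ B) :=
  ModuleCat.ofHom (Submodule.mapQ A B (LinearMap.mulLeft R r) h)

/-- `J^m : x^m` -/
def colonPow (J : Ideal R) (x : R) (m : ℕ) : Ideal R :=
  Submodule.comap (LinearMap.mulLeft R (x ^ m)) (J ^ m)

lemma mem_colonPow {J : Ideal R} {x : R} {m : ℕ} {a : R} :
    a ∈ colonPow J x m ↔ x ^ m * a ∈ J ^ m := Iff.rfl

/-- `0 → R/(J^m : x^m) → R/J^m → R/(J^m + x^m) → 0` -/
abbrev seqS (J : Ideal R) (x : R) (m : ℕ) : ShortComplex (ModuleCat.{0} R) where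
  X₁ := ModuleCat.of R (R ⧸ colonPow J x m)
  X₂ := ModuleCat.of R (R ⧸ J ^ m)
  X₃ := ModuleCat.of R (R ⧸ (J ^ m ⊔ Ideal.span {x ^ m}))
  f := mq (x ^ m) (fun _ ha => ha)
  g := qmap le_sup_left
  zero := by
    ext
    change Submodule.Quotient.mk _ = (0 : R ⧸ (J ^ m ⊔ Ideal.span {x ^ m}))
    rw [Submodule.Quotient.mk_eq_zero]
    refine Ideal.mul_mem_right _ _ (Ideal.mem_sup_right (Ideal.mem_span_singleton_self _))

lemma seqS_exact (J : Ideal R) (x : R) (m : ℕ) : (seqS J x m).ShortExact := by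
  apply ModuleCat.shortComplex_shortExact
  · intro y
    constructor
    · obtain ⟨y, rfl⟩ := Submodule.Quotient.mk_surjective _ y
      intro h
      have h' : y ∈ J ^ m ⊔ Ideal.span {x ^ m} := (Submodule.Quotient.mk_eq_zero _).1 h
      obtain ⟨a, ha, b, hb, rfl⟩ := Submodule.mem_sup.1 h'
      obtain ⟨c, rfl⟩ := Ideal.mem_span_singleton'.1 hb
      refine ⟨Submodule.Quotient.mk c, ?_⟩
      change Submodule.Quotient.mk (x ^ m * c) = _
      refine (Submodule.Quotient.eq _).2 ?_
      have : x ^ m * c - (a + c * x ^ m) = - a := by ring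
      rw [this]; exact neg_mem ha
    · rintro ⟨z, rfl⟩
      exact congr($((seqS J x m).zero).hom z)
  · change Function.Injective (Submodule.mapQ (colonPow J x m) (J ^ m) (LinearMap.mulLeft R (x ^ m)) (fun _ ha => ha))
    refine LinearMap.ker_eq_bot.1 (Submodule.ker_liftQ_eq_bot _ _ _ ?_)
    intro a ha
    have : Submodule.Quotient.mk (x ^ m * a) = (0 : R ⧸ J ^ m) := ha
    have h2 : x ^ m * a ∈ J ^ m := (Submodule.Quotient.mk_eq_zero _).1 this
    exact h2
  · intro y
    obtain ⟨y, rfl⟩ := Submodule.Quotient.mk_surjective _ y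
    exact ⟨Submodule.Quotient.mk y, rfl⟩

lemma bound_le {J : Ideal R} {x : R} {m k : ℕ} (h : m ≤ k) :
    J ^ k ⊔ Ideal.span {x ^ k} ≤ J ^ m ⊔ Ideal.span {x ^ m} :=
  sup_le_sup (Ideal.pow_le_pow_right h)
    ((Ideal.span_singleton_le_span_singleton).2 (pow_dvd_pow x h))

/-- transition map -/
def seqMap (J : Ideal R) (x : R) (m d : ℕ) : seqS J x (m + d) ⟶ seqS J x m where
  τ₁ := mq (x ^ d) (fun a ha => by
    rw [mem_colonPow] at ha ⊢
    rw [← mul_assoc, ← pow_add]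
    exact Ideal.pow_le_pow_right (Nat.le_add_right m d) ha)
  τ₂ := qmap (Ideal.pow_le_pow_right (Nat.le_add_right m d))
  τ₃ := qmap (bound_le (Nat.le_add_right m d))
  comm₁₂ := by
    refine ModuleCat.hom_ext (LinearMap.ext fun y => ?_)
    obtain ⟨y, rfl⟩ := Submodule.Quotient.mk_surjective _ y
    change Submodule.Quotient.mk (x ^ m * (x ^ d * y)) =
      (Submodule.Quotient.mk (x ^ (m + d) * y) : R ⧸ J ^ m)
    congr 1
    ring
  comm₂₃ := by
    refine ModuleCat.hom_ext (LinearMap.ext fun y => ?_)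
    obtain ⟨y, rfl⟩ := Submodule.Quotient.mk_surjective _ y
    rfl

lemma exists_stab [IsNoetherianRing R] (L : Ideal R) (x : R) :
    ∃ s₀ : ℕ, ∀ s a, x ^ s * a ∈ L → x ^ s₀ * a ∈ L := by
  let f : ℕ →o Ideal R := ⟨fun s => Submodule.comap (LinearMap.mulLeft R (x ^ s)) L, by
    intro s t hst a ha
    obtain ⟨d, rfl⟩ := Nat.exists_eq_add_of_le hst
    change x ^ (s + d) * a ∈ L
    rw [add_comm, pow_add, mul_assoc]
    exact Ideal.mul_mem_left _ _ ha⟩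
  obtain ⟨s₀, hs⟩ := monotone_stabilizes_iff_noetherian.2 ‹_› f
  refine ⟨s₀, fun s a h => ?_⟩
  have h1 : a ∈ f (max s₀ s) := f.monotone (le_max_right _ _) h
  rw [← hs _ (le_max_left _ _)] at h1
  exact h1

lemma Dies.step [IsNoetherianRing R] {J : Ideal R} {x : R} {i : ℕ} {M : ModuleCat.{0} R}
    (h : Dies J i M) (h' : Dies J (i+1) M) : Dies (J ⊔ Ideal.span {x}) (i+1) M := by
  intro n ξ
  have hB : ∀ n, J ^ n ⊔ Ideal.span {x ^ n} ≤ (J ⊔ Ideal.span {x}) ^ n := fun n =>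
    sup_le (Ideal.pow_right_mono le_sup_left n) (by
      rw [← Ideal.span_singleton_pow]; exact Ideal.pow_right_mono le_sup_right n)
  obtain ⟨m, hm, h1⟩ := h' n (pb (qmap (le_sup_left.trans (hB n))) ξ)
  change pb _ _ = 0 at h1
  rw [pb_pb, qmap_comp] at h1
  let ξ₂ : Abelian.Ext.{0} (seqS J x m).X₃ M (i+1) := pb (qmap ((bound_le hm).trans (hB n))) ξ
  have h2 : pb (seqS J x m).g ξ₂ = 0 := by
    exact (pb_pb _ _ _).trans ((congrArg (fun t => pb t ξ) (qmap_comp _ _)).trans h1)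
  obtain ⟨η, hη⟩ : ∃ η : Abelian.Ext.{0} (ModuleCat.of R (R ⧸ colonPow J x m)) M i, _ :=
    Ext.contravariant_sequence_exact₃ (seqS_exact J x m) M ξ₂ h2 (add_comm 1 i)
  have hC : J ^ m ≤ colonPow J x m := fun a ha => Ideal.mul_mem_left _ _ ha
  obtain ⟨l, hl, h3⟩ := h m (pb (qmap hC) η)
  change pb _ _ = 0 at h3
  rw [pb_pb, qmap_comp] at h3
  obtain ⟨s₀, hs⟩ := exists_stab (J ^ l) x
  obtain ⟨d, hd⟩ : ∃ d, m + d = l + s₀ := ⟨l + s₀ - m, by omega⟩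
  have hds : s₀ ≤ d := by omega
  have hmem : ∀ a ∈ colonPow J x (m + d), x ^ d * a ∈ J ^ l := by
    intro a ha
    obtain ⟨t, rfl⟩ := Nat.exists_eq_add_of_le hds
    rw [add_comm, pow_add, mul_assoc]
    refine Ideal.mul_mem_left _ _ (hs (m + (s₀ + t)) a ?_)
    exact Ideal.pow_le_pow_right (by omega) ha
  have h4 : pb (seqMap J x m d).τ₁ η = 0 := by
    have : (seqMap J x m d).τ₁ = mq (x ^ d) hmem ≫ qmap ((Ideal.pow_le_pow_right hl).trans hC) := by
      ext; rfl
    rw [this, ← pb_pb]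
    rw [h3, pb, Ext.comp_zero]
  have h5 : pb (seqMap J x m d).τ₃ ξ₂ = 0 := by
    rw [← hη, pb, ← Ext.comp_assoc _ _ _ (zero_add 1) (add_comm 1 i) (by omega),
      ← ShortComplex.ShortExact.extClass_naturality (seqS_exact J x (m+d)),
      Ext.comp_assoc_of_second_deg_zero]
    rw [show (Ext.mk₀ (seqMap J x m d).τ₁).comp η (zero_add i) = 0 from h4, Ext.comp_zero]
  have hN : (J ⊔ Ideal.span {x}) ^ ((m + d) + (m + d)) ≤ J ^ (m+d) ⊔ Ideal.span {x ^ (m+d)} := by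
    rw [← Ideal.span_singleton_pow]
    exact Ideal.sup_pow_add_le_pow_sup_pow
  refine ⟨(m + d) + (m + d), by omega, ?_⟩
  have h6 : pb (qmap hN) (pb (qmap (bound_le (Nat.le_add_right m d)))
      (pb (qmap ((bound_le hm).trans (hB n))) ξ)) = 0 := by
    refine (congrArg (pb (qmap hN)) h5).trans ?_
    exact Ext.comp_zero _ _ _ _ _
  rw [pb_pb, pb_pb, qmap_comp, qmap_comp] at h6
  exact h6

lemma Dies.bot {i : ℕ} (M : ModuleCat.{0} R) : Dies (⊥ : Ideal R) (i+1) M := by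
  intro n ξ
  refine ⟨n+1, by omega, ?_⟩
  have h0 : (⊥ : Ideal R) ^ (n+1) = ⊥ := by simp
  have : Module.Projective R (R ⧸ (⊥ : Ideal R) ^ (n+1)) := by
    rw [h0]
    exact Module.Projective.of_equiv (Submodule.quotEquivOfEqBot (⊥ : Ideal R) rfl).symm
  have : Projective (ModuleCat.of R (R ⧸ (⊥ : Ideal R) ^ (n+1))) :=
    (IsProjective.iff_projective _).1 this
  exact Ext.eq_zero_of_projective _

lemma exists_bound [IsNoetherianRing R] (I : Ideal R) :
    ∃ K : ℕ, ∀ i, K < i → ∀ M : ModuleCat.{0} R, Dies I i M := by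
  obtain ⟨s, rfl⟩ := IsNoetherian.noetherian I
  classical
  induction s using Finset.induction_on with
  | empty =>
    refine ⟨0, fun i hi M => ?_⟩
    obtain ⟨j, rfl⟩ := Nat.exists_eq_succ_of_ne_zero hi.ne'
    simpa using Dies.bot M
  | insert x s _ ih =>
    obtain ⟨K, hK⟩ := ih
    refine ⟨K+1, fun i hi M => ?_⟩
    obtain ⟨j, rfl⟩ := Nat.exists_eq_succ_of_ne_zero (show i ≠ 0 by omega)
    have := Dies.step (x := x) (hK j (by omega) M) (hK (j+1) (by omega) M)
    have e : Submodule.span R (↑(insert x s) : Set R) = Submodule.span R ↑s ⊔ Ideal.span {x} := by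
      rw [Finset.coe_insert, Submodule.span_insert, sup_comm]
    rw [e]; exact this

end vanish

section final
variable {R : Type} [CommRing R]

lemma cohDim_le_iff [IsNoetherianRing R] (I : Ideal R) (M : Type) [AddCommGroup M] [Module R M]
    (d : ℕ) : cohDim I M ≤ d ↔ ∀ i, d < i → Dies I i (ModuleCat.of R M) := by
  obtain ⟨K, hK⟩ := exists_bound I
  have hb : BddAbove {i : ℕ | Nontrivial ((localCohomology I i).obj (ModuleCat.of R M))} := by
    refine ⟨K, fun i hi => ?_⟩
    by_contra! h
    obtain ⟨j, rfl⟩ := Nat.exists_eq_succ_of_ne_zero (show i ≠ 0 by omega)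
    exact (dies_iff I j _).2 (hK _ h _) hi
  unfold cohDim
  rw [csSup_le_iff' hb]
  constructor
  · intro h i hi
    obtain ⟨j, rfl⟩ := Nat.exists_eq_succ_of_ne_zero (show i ≠ 0 by omega)
    refine (dies_iff I j _).1 fun hn => ?_
    have := h _ hn
    omega
  · intro h i hi
    by_contra! hl
    obtain ⟨j, rfl⟩ := Nat.exists_eq_succ_of_ne_zero (show i ≠ 0 by omega)
    exact (dies_iff I j _).2 (h _ hl) hi

lemma Dies.of_subsingleton (I : Ideal R) (i : ℕ) (M : Type) [AddCommGroup M] [Module R M]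
    [Subsingleton M] : Dies I i (ModuleCat.of R M) := by
  intro n ξ
  refine ⟨n, le_rfl, ?_⟩
  have h : (𝟙 (ModuleCat.of R M)) = 0 := by
    ext x; exact Subsingleton.elim _ _
  have h2 : ξ = 0 := by
    rw [← Abelian.Ext.comp_mk₀_id ξ, h, Abelian.Ext.mk₀_zero, Abelian.Ext.comp_zero]
  rw [h2, Abelian.Ext.comp_zero]

section
variable {I : Ideal R} {i : ℕ} {A B C : Type} [AddCommGroup A] [Module R A]
    [AddCommGroup B] [Module R B] [AddCommGroup C] [Module R C]

lemma ses_aux {f : A →ₗ[R] B} {g : B →ₗ[R] C}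
    (hf : Function.Injective f) (hg : Function.Surjective g) (hfg : Function.Exact f g) :
    (ShortComplex.mk (ModuleCat.ofHom f) (ModuleCat.ofHom g)
      (by ext x; exact hfg.apply_apply_eq_zero x)).ShortExact :=
  ModuleCat.shortComplex_shortExact _ hfg hf hg

lemma Dies.mid' {f : A →ₗ[R] B} {g : B →ₗ[R] C}
    (hf : Function.Injective f) (hg : Function.Surjective g) (hfg : Function.Exact f g)
    (h1 : Dies I i (ModuleCat.of R A)) (h3 : Dies I i (ModuleCat.of R C)) :
    Dies I i (ModuleCat.of R B) :=
  Dies.mid (ses_aux hf hg hfg) h1 h3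

lemma Dies.right' {f : A →ₗ[R] B} {g : B →ₗ[R] C}
    (hf : Function.Injective f) (hg : Function.Surjective g) (hfg : Function.Exact f g)
    (h2 : Dies I i (ModuleCat.of R B)) (h1 : Dies I (i+1) (ModuleCat.of R A)) :
    Dies I i (ModuleCat.of R C) :=
  Dies.right (ses_aux hf hg hfg) h2 h1

lemma Dies.equiv (e : A ≃ₗ[R] B) (h : Dies I i (ModuleCat.of R A)) :
    Dies I i (ModuleCat.of R B) :=
  Dies.mid' (f := e.toLinearMap) (g := (0 : B →ₗ[R] PUnit.{1})) e.injective
    (Function.surjective_to_subsingleton _) ((e.exact_zero_iff_surjective _).2 e.surjective) h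
    (Dies.of_subsingleton _ _ _)
end

lemma claim2 [IsNoetherianRing R] (I : Ideal R) (i : ℕ) (X : Type) [AddCommGroup X] [Module R X]
    [hX : Module.Finite R X]
    (h : ∀ p ∈ Module.support R X, Dies I i (ModuleCat.of R (R ⧸ p.asIdeal))) :
    Dies I i (ModuleCat.of R X) := by
  induction hX using IsNoetherianRing.induction_on_isQuotientEquivQuotientPrime R with
  | subsingleton N => exact Dies.of_subsingleton _ _ _
  | quotient N p e =>
    refine Dies.equiv e.symm (h p ?_)
    rw [e.support_eq, Module.mem_support_iff_of_finite]
    exact (Ideal.annihilator_quotient).le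
  | exact N₁ N₂ N₃ f g hf hg hfg h₁ h₃ =>
    rw [Module.support_of_exact hfg hf hg] at h
    exact Dies.mid' hf hg hfg (h₁ fun p hp => h p (Or.inl hp)) (h₃ fun p hp => h p (Or.inr hp))

lemma exists_map [IsNoetherianRing R] (L : Type) [AddCommGroup L] [Module R L]
    [Module.Finite R L] (p : Ideal R) [hp : p.IsPrime] (h : Module.annihilator R L ≤ p) :
    ∃ φ : L →ₗ[R] R ⧸ p, φ ≠ 0 := by
  by_contra! hn
  have : Subsingleton (L →ₗ[R] R ⧸ p) := ⟨fun a b => by rw [hn a, hn b]⟩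
  obtain ⟨r, hr, hreg⟩ := IsSMulRegular.subsingleton_linearMap_iff.1 this
  have h1 : r • (1 : R ⧸ p) = r • (0 : R ⧸ p) := by
    rw [smul_zero, Algebra.smul_def, mul_one]
    exact Ideal.Quotient.eq_zero_iff_mem.2 (h hr)
  exact one_ne_zero (hreg h1)

lemma claim1 [IsNoetherianRing R] (I : Ideal R) (i : ℕ) (L : Type) [AddCommGroup L] [Module R L]
    [Module.Finite R L] (hL : Dies I i (ModuleCat.of R L))
    (hup : ∀ (X : Type) [AddCommGroup X] [Module R X] [Module.Finite R X],
      Module.support R X ⊆ Module.support R L → Dies I (i+1) (ModuleCat.of R X))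
    (p : Ideal R) : p.IsPrime → Module.annihilator R L ≤ p →
      Dies I i (ModuleCat.of R (R ⧸ p)) := by
  induction p using WellFoundedGT.induction with
  | ind p ih =>
  intro hp hle
  obtain ⟨φ, hφ⟩ := exists_map L p hle
  have hr : Dies I i (ModuleCat.of R (LinearMap.range φ)) := by
    refine Dies.right' (f := (LinearMap.ker φ).subtype) (g := φ.rangeRestrict)
      Subtype.val_injective φ.surjective_rangeRestrict ?_ hL (hup _ ?_)
    · rw [LinearMap.exact_iff]; simp
    · exact Module.support_subset_of_injective _ (LinearMap.ker φ).subtype_injective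
  refine Dies.mid' (f := (LinearMap.range φ).subtype) (g := (LinearMap.range φ).mkQ)
    Subtype.val_injective (Submodule.mkQ_surjective _)
    (LinearMap.exact_subtype_mkQ _) hr (claim2 I i _ fun q hq => ?_)
  rw [Module.mem_support_iff_of_finite] at hq
  have hpq : p ≤ q.asIdeal := fun a ha => hq (by
    rw [Module.mem_annihilator]
    intro m
    obtain ⟨m, rfl⟩ := Submodule.mkQ_surjective _ m
    obtain ⟨m, rfl⟩ := Ideal.Quotient.mk_surjective m
    rw [← map_smul, Algebra.smul_def, Ideal.Quotient.algebraMap_eq,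
      Ideal.Quotient.eq_zero_iff_mem.2 ha, zero_mul, map_zero])
  refine ih q.asIdeal (lt_of_le_of_ne hpq ?_) q.isPrime (hle.trans hpq)
  intro heq
  obtain ⟨x, hx⟩ : ∃ x, φ x ≠ 0 := by
    by_contra! hh
    exact hφ (LinearMap.ext hh)
  obtain ⟨y, hy⟩ := Ideal.Quotient.mk_surjective (φ x)
  have hyp : y ∉ p := fun h => hx (by rw [← hy]; exact Ideal.Quotient.eq_zero_iff_mem.2 h)
  refine hyp (heq ▸ hq ?_)
  rw [Module.mem_annihilator]
  intro m
  obtain ⟨m, rfl⟩ := Submodule.mkQ_surjective _ m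
  obtain ⟨m, rfl⟩ := Ideal.Quotient.mk_surjective m
  rw [← map_smul, Submodule.mkQ_apply, Submodule.Quotient.mk_eq_zero]
  refine ⟨m • x, ?_⟩
  rw [map_smul, ← hy, Algebra.smul_def, Algebra.smul_def, mul_comm]
  rfl

lemma thmA [IsNoetherianRing R] (I : Ideal R) (d : ℕ) (L : Type) [AddCommGroup L] [Module R L]
    [Module.Finite R L] (hL : ∀ i, d < i → Dies I i (ModuleCat.of R L))
    (X : Type) [AddCommGroup X] [Module R X] [Module.Finite R X]
    (hX : Module.support R X ⊆ Module.support R L) (i : ℕ) (hi : d < i) :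
    Dies I i (ModuleCat.of R X) := by
  obtain ⟨K, hK⟩ := exists_bound I
  suffices H : ∀ k i, d < i → K < i + k → ∀ (X : Type) [AddCommGroup X] [Module R X]
      [Module.Finite R X], Module.support R X ⊆ Module.support R L →
      Dies I i (ModuleCat.of R X) from H (K+1) i hi (by omega) X hX
  intro k
  induction k with
  | zero => intro i _ h X _ _ _ _; exact hK i (by omega) _
  | succ k ih =>
    intro i hi h X _ _ _ hX
    refine claim2 I i X fun p hp => claim1 I i L (hL i hi)
      (fun Y _ _ _ hY => ih (i+1) (by omega) (by omega) Y hY) p.asIdeal p.isPrime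
      (Module.annihilator_le_of_mem_support (hX hp))

lemma thmA_cd [IsNoetherianRing R] (I : Ideal R) (d : ℕ) (L : Type) [AddCommGroup L] [Module R L]
    [Module.Finite R L] (hL : cohDim I L ≤ d) (q : Ideal R) [hq : q.IsPrime]
    (hle : Module.annihilator R L ≤ q) : cohDim I (R ⧸ q) ≤ d := by
  rw [cohDim_le_iff] at hL ⊢
  refine thmA I d L hL (R ⧸ q) ?_
  intro p hp
  rw [Module.mem_support_iff_of_finite] at hp ⊢
  rw [Ideal.annihilator_quotient] at hp
  exact hle.trans hp

end final

end

/-- Corollary 2.18: let `(0) = N₁ ∩ … ∩ Nₙ` be a reduced primary decomposition of the zero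
submodule of `M`, with `N_j` being `𝔭_j`-primary, and set `M_i = ∩_{cd(𝔞,R/𝔭_j) > i} N_j`.
If `cd(𝔞, ∩_{cd(𝔞,R/𝔭_j) > 0} N_j) = 0`, then `{M_i}_{i=0}^c` is the cd-filtration of `M`. -/
theorem stmt18 {R : Type} [CommRing R] [IsNoetherianRing R]
    (𝔞 : Ideal R) (h𝔞 : 𝔞 ≠ ⊤)
    (M : Type) [AddCommGroup M] [Module R M] [Module.Finite R M]
    (c : ℕ) (hc : c = cohDim 𝔞 M)
    (n : ℕ) (N : Fin n → Submodule R M) (p : Fin n → Ideal R)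
    (hprimary : ∀ j, associatedPrimes R (M ⧸ N j) = {p j})
    (hzero : (⨅ j, N j) = ⊥)
    (hirredundant : ∀ j, ¬ (⨅ k ∈ {k | k ≠ j}, N k) ≤ N j)
    (hdistinct : Function.Injective p)
    (h0 : cohDim 𝔞 ↥(⨅ j ∈ {j | 0 < cohDim 𝔞 (R ⧸ p j)}, N j) = 0) :
    IsCdFiltration 𝔞 c (fun i => ⨅ j ∈ {j | i < cohDim 𝔞 (R ⧸ p j)}, N j) := by
  have hpp : ∀ j, (p j).IsPrime := fun j => by
    have : p j ∈ associatedPrimes R (M ⧸ N j) := by rw [hprimary]; rfl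
    exact IsAssociatedPrime.isPrime this
  intro i _
  dsimp only
  constructor
  · rw [cohDim_le_iff]
    intro i' hi'
    refine claim2 _ _ _ fun q hq => ?_
    suffices cohDim 𝔞 (R ⧸ q.asIdeal) ≤ i from (cohDim_le_iff _ _ _).1 this _ hi'
    rw [Module.mem_support_iff_of_finite] at hq
    classical
    let T : Finset (Fin n) := Finset.univ.filter fun j => ¬ i < cohDim 𝔞 (R ⧸ p j)
    have hT : T.inf (fun j => Module.annihilator R (M ⧸ N j)) ≤ q.asIdeal := by
      refine le_trans ?_ hq
      intro a ha
      rw [Module.mem_annihilator]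
      rintro ⟨m, hm⟩
      rw [Subtype.ext_iff]
      change a • m = 0
      have : a • m ∈ ⨅ j, N j := by
        rw [Submodule.mem_iInf]
        intro j
        by_cases hj : i < cohDim 𝔞 (R ⧸ p j)
        · refine (N j).smul_mem _ ?_
          simp only [Submodule.mem_iInf] at hm
          exact hm j hj
        · have h1 : T.inf (fun j => Module.annihilator R (M ⧸ N j)) ≤
            Module.annihilator R (M ⧸ N j) := Finset.inf_le (by simp [T]; omega)
          have h2 := Module.mem_annihilator.1 (h1 ha) (Submodule.Quotient.mk m)
          rwa [← Submodule.Quotient.mk_smul, Submodule.Quotient.mk_eq_zero] at h2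
      rwa [hzero, Submodule.mem_bot] at this
    obtain ⟨j, hj, hjq⟩ := (Ideal.IsPrime.inf_le' q.isPrime).1 hT
    have hj' : cohDim 𝔞 (R ⧸ p j) ≤ i := by simpa [T] using hj
    obtain ⟨q', hq', hqq⟩ := Ideal.exists_minimalPrimes_le hjq
    have := Module.associatedPrimes.minimalPrimes_annihilator_subset_associatedPrimes R _ hq'
    rw [hprimary, Set.mem_singleton_iff] at this
    subst this
    refine thmA_cd 𝔞 i (R ⧸ p j) hj' q.asIdeal ?_
    rwa [Ideal.annihilator_quotient]
  · intro N' hN'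
    refine le_iInf₂ fun j hj => ?_
    by_contra hnle
    have hj : i < cohDim 𝔞 (R ⧸ p j) := hj
    refine absurd (thmA_cd 𝔞 i N' hN' (p j) ?_) (by omega)
    let ψ : N' →ₗ[R] M ⧸ N j := (N j).mkQ ∘ₗ N'.subtype
    have hnt : Nontrivial (LinearMap.range ψ) := by
      rw [Submodule.nontrivial_iff_ne_bot]
      intro hb
      apply hnle
      intro x hx
      have := LinearMap.congr_fun (LinearMap.range_eq_bot.1 hb) ⟨x, hx⟩
      exact (Submodule.Quotient.mk_eq_zero _).1 this
    obtain ⟨q, hq⟩ := associatedPrimes.nonempty R (LinearMap.range ψ)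
    have h1 := associatedPrimes.subset_of_injective (LinearMap.range ψ).subtype_injective hq
    rw [hprimary, Set.mem_singleton_iff] at h1
    subst h1
    have h2 := IsAssociatedPrime.annihilator_le hq
    rw [Submodule.annihilator_top] at h2
    exact (LinearMap.annihilator_le_of_surjective _ ψ.surjective_rangeRestrict).trans h2
end

section
/- Let f : R → R' be a faithfully flat homomorphism of Noetherian rings and 𝔞 ⊊ R a proper ideal. Then R is relative Cohen-Macaulay with respect to 𝔞 if and only if R' is relative Cohen-Macaulay with respect to 𝔞R'. -/
open CategoryTheory

section partA
variable {R : Type} [CommRing R]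

lemma aux_epi_surj [IsNoetherianRing R] {X Y : FGModuleCat.{0} R} (f : X ⟶ Y) [Epi f] :
    Function.Surjective f.hom.hom := by
  have : Epi ((forget₂ (FGModuleCat.{0} R) (ModuleCat.{0} R)).map f) := inferInstance
  exact (ModuleCat.epi_iff_surjective _).1 this

lemma aux_proj [IsNoetherianRing R] (n : ℕ) : Projective (FGModuleCat.of R (Fin n → R)) where
  factors {E X} f e he := by
    obtain ⟨g, hg⟩ := Module.projective_lifting_property e.hom.hom f.hom.hom (aux_epi_surj e)
    exact ⟨FGModuleCat.ofHom g, FGModuleCat.hom_ext hg⟩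

lemma aux_cover [IsNoetherianRing R] (X : FGModuleCat.{0} R) :
    ∃ (n : ℕ) (f : FGModuleCat.of R (Fin n → R) ⟶ X), Epi f := by
  obtain ⟨n, f, hf⟩ := Module.Finite.exists_fin' R X
  refine ⟨n, FGModuleCat.ofHom f, ?_⟩
  have : Epi ((forget₂ (FGModuleCat.{0} R) (ModuleCat.{0} R)).map (FGModuleCat.ofHom f)) :=
    (ModuleCat.epi_iff_surjective _).2 hf
  exact (forget₂ (FGModuleCat.{0} R) (ModuleCat.{0} R)).epi_of_epi_map this

lemma aux_enough [IsNoetherianRing R] : EnoughProjectives (FGModuleCat.{0} R) where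
  presentation X := by
    obtain ⟨n, f, hf⟩ := aux_cover X
    exact ⟨{ p := _, projective := aux_proj n, f := f, epi := hf }⟩

lemma aux_pres [IsNoetherianRing R] :
    (forget₂ (FGModuleCat.{0} R) (ModuleCat.{0} R)).PreservesProjectiveObjects where
  projective_obj {X} hX := by
    obtain ⟨n, f, hf⟩ := aux_cover X
    let s := Projective.factorThru (𝟙 X) f
    have hs : s ≫ f = 𝟙 X := Projective.factorThru_comp _ _
    have : Module.Projective R X := Module.Projective.of_split s.hom.hom f.hom.hom
      (congr(($hs).hom.hom))
    exact (IsProjective.iff_projective X).1 this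

lemma exists_fg_res [IsNoetherianRing R] (M : Type) [AddCommGroup M] [Module R M]
    [Module.Finite R M] :
    ∃ P : ProjectiveResolution (ModuleCat.of R M), ∀ n, Module.Finite R (P.complex.X n) := by
  have := aux_enough (R := R)
  have := aux_pres (R := R)
  let P := ProjectiveResolution.of (FGModuleCat.of R M)
  exact ⟨(forget₂ (FGModuleCat.{0} R) (ModuleCat.{0} R)).mapProjectiveResolution P,
    fun n => (P.complex.X n).property⟩

open TensorProduct

lemma dualTensorHom_comp_aux {M N : Type} [AddCommGroup M] [Module R M] [AddCommGroup N]
    [Module R N] (Y : Type) [AddCommGroup Y] [Module R Y] (p : M →ₗ[R] N)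
    (x : Module.Dual R N ⊗[R] Y) :
    dualTensorHom R M Y (p.dualMap.rTensor Y x) = (dualTensorHom R N Y x) ∘ₗ p := by
  induction x with
  | zero => simp
  | add x y hx hy => simp [hx, hy, LinearMap.add_comp]
  | tmul f y => ext m; simp

lemma dualTensorHom_bij (M Y : Type) [AddCommGroup M] [Module R M] [AddCommGroup Y] [Module R Y]
    [Module.Finite R M] [Module.Projective R M] : Function.Bijective (dualTensorHom R M Y) := by
  obtain ⟨n, p, s, -, -, hps⟩ := Module.Finite.exists_comp_eq_id_of_projective R M
  have hb : Function.Bijective (dualTensorHom R (Fin n → R) Y) :=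
    (dualTensorHomEquiv R (Fin n → R) Y).bijective
  have hss : ∀ x, s.dualMap.rTensor Y (p.dualMap.rTensor Y x) = x := by
    intro x
    rw [← LinearMap.comp_apply, ← LinearMap.rTensor_comp, LinearMap.dualMap_comp_dualMap, hps]
    simp
  constructor
  · rw [injective_iff_map_eq_zero]
    intro x hx
    have : p.dualMap.rTensor Y x = 0 := hb.1 (by rw [dualTensorHom_comp_aux, hx]; simp)
    rw [← hss x, this, map_zero]
  · intro f
    obtain ⟨y, hy⟩ := hb.2 (f ∘ₗ p)
    exact ⟨s.dualMap.rTensor Y y, by rw [dualTensorHom_comp_aux, hy, LinearMap.comp_assoc, hps]; simp⟩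

lemma ff_crit {A B A' B' : Type} [AddCommGroup A] [Module R A] [AddCommGroup B] [Module R B]
    [AddCommGroup A'] [Module R A'] [AddCommGroup B'] [Module R B']
    (Y : Type) [AddCommGroup Y] [Module R Y] [Module.FaithfullyFlat R Y]
    (T : A →ₗ[R] B) (ψ : A →ₗ[R] A') (e : B' →ₗ[R] A') :
    (∀ z, T z = 0 → ∃ w, e w = ψ z) ↔
      (∀ z, T.rTensor Y z = 0 → ∃ w, e.rTensor Y w = ψ.rTensor Y z) := by
  let c : LinearMap.ker T →ₗ[R] A' ⧸ LinearMap.range e :=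
    (LinearMap.range e).mkQ ∘ₗ ψ ∘ₗ (LinearMap.ker T).subtype
  have h1 : (∀ z, T z = 0 → ∃ w, e w = ψ z) ↔ c = 0 := by
    rw [LinearMap.ext_iff]
    simp [c]
  have ex1 : Function.Exact ((LinearMap.ker T).subtype.rTensor Y) (T.rTensor Y) :=
    Module.Flat.rTensor_exact Y (LinearMap.exact_subtype_ker_map T)
  have ex2 : Function.Exact (e.rTensor Y) ((LinearMap.range e).mkQ.rTensor Y) :=
    rTensor_exact Y (LinearMap.exact_map_mkQ_range e) (Submodule.mkQ_surjective _)
  rw [h1, Module.FaithfullyFlat.zero_iff_rTensor_zero R Y, LinearMap.ext_iff]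
  simp only [c, LinearMap.rTensor_comp, LinearMap.comp_apply, LinearMap.zero_apply]
  constructor
  · intro h z hz
    obtain ⟨x, rfl⟩ := (ex1 z).1 hz
    exact (ex2 _).1 (h x)
  · intro h x
    exact (ex2 _).2 (h _ ((ex1 _).2 ⟨x, rfl⟩))

/-- criterion in terms of Hom -/
lemma hom_crit {P0 P1 Q1 Q2 : Type} [AddCommGroup P0] [Module R P0] [AddCommGroup P1] [Module R P1]
    [AddCommGroup Q1] [Module R Q1] [AddCommGroup Q2] [Module R Q2]
    [Module.Finite R P0] [Module.Projective R P0] [Module.Finite R P1] [Module.Projective R P1]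
    [Module.Finite R Q1] [Module.Projective R Q1] [Module.Finite R Q2] [Module.Projective R Q2]
    (Y : Type) [AddCommGroup Y] [Module R Y] [Module.FaithfullyFlat R Y]
    (d : Q2 →ₗ[R] Q1) (ψ : P1 →ₗ[R] Q1) (e : P1 →ₗ[R] P0) :
    (∀ z : Q1 →ₗ[R] R, z ∘ₗ d = 0 → ∃ w : P0 →ₗ[R] R, w ∘ₗ e = z ∘ₗ ψ) ↔
    (∀ z : Q1 →ₗ[R] Y, z ∘ₗ d = 0 → ∃ w : P0 →ₗ[R] Y, w ∘ₗ e = z ∘ₗ ψ) := by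
  refine (ff_crit Y d.dualMap ψ.dualMap e.dualMap).trans ?_
  rw [(dualTensorHom_bij Q1 Y).2.forall]
  simp only [(dualTensorHom_bij P0 Y).2.exists, ← dualTensorHom_comp_aux,
    (dualTensorHom_bij P1 Y).1.eq_iff]
  refine forall_congr' fun z => ?_
  rw [map_eq_zero_iff _ (dualTensorHom_bij Q2 Y).1]
end partA
section partB
variable {R : Type} [CommRing R]

lemma sc_crit {S T : ShortComplex (ModuleCat.{0} R)} (f : S ⟶ T) :
    ShortComplex.homologyMap f = 0 ↔
      ∀ z : S.X₂, S.g z = 0 → ∃ w : T.X₁, T.f w = f.τ₂ z := by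
  have hT : (ShortComplex.mk T.toCycles T.homologyπ (by simp)).Exact :=
    ShortComplex.exact_of_g_is_cokernel _ T.homologyIsCokernel
  have hS : (ShortComplex.mk S.iCycles S.g (by simp)).Exact :=
    ShortComplex.exact_of_f_is_kernel _ S.cyclesIsKernel
  have hi : Function.Injective T.iCycles := (ModuleCat.mono_iff_injective _).1 inferInstance
  rw [← cancel_epi S.homologyπ, Limits.comp_zero, ShortComplex.homologyπ_naturality]
  rw [ShortComplex.moduleCat_exact_iff] at hT hS
  have key : ∀ x : S.cycles, T.iCycles (ShortComplex.cyclesMap f x) = f.τ₂ (S.iCycles x) := by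
    intro x
    have := ShortComplex.cyclesMap_i f
    exact congr(($this).hom x)
  have key2 : ∀ w : T.X₁, T.iCycles (T.toCycles w) = T.f w := by
    intro x
    have := T.toCycles_i
    exact congr(($this).hom x)
  constructor
  · intro h z hz
    obtain ⟨x, hx⟩ := hS z hz
    change S.iCycles x = z at hx
    obtain ⟨w, hw⟩ := hT (ShortComplex.cyclesMap f x) congr(($h).hom x)
    refine ⟨w, ?_⟩
    rw [← key2, ← hx, ← key, ← hw]
  · intro h
    ext x
    obtain ⟨w, hw⟩ := h (S.iCycles x) (by
      have := S.iCycles_g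
      exact congr(($this).hom x))
    have : ShortComplex.cyclesMap f x = T.toCycles w := hi (by rw [key, key2, hw])
    have h0 := T.toCycles_comp_homologyπ
    change T.homologyπ (ShortComplex.cyclesMap f x) = 0
    rw [this]
    exact congr(($h0).hom w)

lemma zero_iff_of_iso_sq {C : Type*} [Category C] [Limits.HasZeroMorphisms C] {A B A' B' : C}
    (f : A ⟶ B) (g : A' ⟶ B') (e : A ≅ A') (e' : B ≅ B') (h : f ≫ e'.hom = e.hom ≫ g) :
    f = 0 ↔ g = 0 := by
  rw [← cancel_mono e'.hom, h, Limits.zero_comp, ← cancel_epi e.hom (g := g), Limits.comp_zero]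

lemma op_crit {S T : ShortComplex (ModuleCat.{0} R)ᵒᵖ} (f : S ⟶ T) :
    ShortComplex.homologyMap f = 0 ↔ ShortComplex.homologyMap (ShortComplex.unopMap f) = 0 := by
  have h := ShortComplex.homologyOpIso_hom_naturality (ShortComplex.unopMap f)
  have h2 := zero_iff_of_iso_sq _ _ _ _ h
  refine Iff.trans h2 ?_
  exact ⟨fun h => Quiver.Hom.op_inj h, fun h => by rw [h]; rfl⟩

lemma ext_crit {M N : ModuleCat.{0} R} (φ : M ⟶ N) (P : ProjectiveResolution M)
    (Q : ProjectiveResolution N) (ψ : P.complex ⟶ Q.complex)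
    (comm : ψ.f 0 ≫ Q.π.f 0 = P.π.f 0 ≫ φ) (Y : ModuleCat.{0} R) (i : ℕ) :
    ((Ext R (ModuleCat.{0} R) i).map φ.op).app Y = 0 ↔
    ∀ z : Q.complex.X i ⟶ Y, Q.complex.d (i+1) i ≫ z = 0 →
      ∃ w : P.complex.X ((ComplexShape.down ℕ).next i) ⟶ Y,
        P.complex.d i _ ≫ w = ψ.f i ≫ z := by
  have h1 : ((Ext R (ModuleCat.{0} R) i).map φ.op).app Y =
    ((((linearYoneda R (ModuleCat.{0} R)).obj Y).rightOp.leftDerived i).map φ).unop := rfl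
  have h2 := ProjectiveResolution.isoLeftDerivedObj_hom_naturality φ P Q ψ comm
    (((linearYoneda R (ModuleCat.{0} R)).obj Y).rightOp) i
  let F := ((linearYoneda R (ModuleCat.{0} R)).obj Y).rightOp
  let α := (F.mapHomologicalComplex (ComplexShape.down ℕ)).map ψ
  have h3 : (F.leftDerived i).map φ = 0 ↔ HomologicalComplex.homologyMap α i = 0 :=
    zero_iff_of_iso_sq _ _ _ _ h2
  have h4 : (F.leftDerived i).map φ = 0 ↔ ((F.leftDerived i).map φ).unop = 0 :=
    ⟨fun h => by rw [h]; rfl, fun h => Quiver.Hom.unop_inj h⟩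
  rw [h1]
  refine h4.symm.trans (h3.trans ?_)
  refine (op_crit _).trans ((sc_crit _).trans ?_)
  have hp : (ComplexShape.down ℕ).prev i = i + 1 := ComplexShape.prev_eq' _ rfl
  rw [← hp]
  rfl
end partB
section partC
variable {R : Type} [CommRing R]

lemma ext_finite [IsNoetherianRing R] {M : ModuleCat.{0} R} (P : ProjectiveResolution M)
    (hP : ∀ n, Module.Finite R (P.complex.X n)) (Y : ModuleCat.{0} R) [Module.Finite R Y] (i : ℕ) :
    Module.Finite R (((Ext R (ModuleCat.{0} R) i).obj (Opposite.op M)).obj Y) := by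
  let K := P.complex.linearYonedaObj R Y
  have h0 : Module.Finite R (K.X i) := by
    have : Module.Finite R (P.complex.X i →ₗ[R] Y) := inferInstance
    exact Module.Finite.equiv (ModuleCat.homLinearEquiv (S := R)).symm
  have h1 : Module.Finite R (K.cycles i) :=
    Module.Finite.of_injective (K.iCycles i).hom ((ModuleCat.mono_iff_injective _).1 inferInstance)
  have h2 : Module.Finite R (K.homology i) :=
    Module.Finite.of_surjective (K.homologyπ i).hom
      ((ModuleCat.epi_iff_surjective _).1 inferInstance)
  exact Module.Finite.equiv (P.isoExt (R := R) i Y).toLinearEquiv.symm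

open Limits in
lemma colim_crit {J : Type} [SmallCategory J] [IsFiltered J] (F : J ⥤ ModuleCat.{0} R)
    [∀ j, Module.Finite R (F.obj j)] :
    Subsingleton (colimit F : ModuleCat.{0} R) ↔ ∀ j, ∃ (k : J) (f : j ⟶ k), F.map f = 0 := by
  constructor
  · intro h j
    obtain ⟨s, hs⟩ := (inferInstance : Module.Finite R (F.obj j)).fg_top
    have key : ∀ t : Finset (F.obj j), ∃ (k : J) (f : j ⟶ k), ∀ x ∈ t, (F.map f).hom x = 0 := by
      classical
      intro t
      induction t using Finset.induction_on with
      | empty => exact ⟨j, 𝟙 j, by simp⟩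
      | insert a t _ ih =>
        obtain ⟨k, f, hf⟩ := ih
        obtain ⟨k', f', hf'⟩ := Concrete.colimit_rep_eq_zero R F j a (Subsingleton.elim _ _)
        obtain ⟨l, g, g', hg⟩ := IsFiltered.span f f'
        refine ⟨l, f ≫ g, ?_⟩
        intro x hx
        rcases Finset.mem_insert.1 hx with rfl | hx
        · rw [hg, F.map_comp, ModuleCat.hom_comp, LinearMap.comp_apply, hf', map_zero]
        · rw [F.map_comp, ModuleCat.hom_comp, LinearMap.comp_apply, hf x hx, map_zero]
    obtain ⟨k, f, hf⟩ := key s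
    refine ⟨k, f, ModuleCat.hom_ext (LinearMap.ext_on hs ?_)⟩
    intro x hx
    exact hf x hx
  · intro h
    refine subsingleton_of_forall_eq 0 fun x => ?_
    obtain ⟨j, y, rfl⟩ := Concrete.colimit_exists_rep F x
    obtain ⟨k, f, hf⟩ := h j
    have := colimit.w F f
    rw [← this, hf]
    simp

open localCohomology Opposite Limits in
lemma lc_crit [IsNoetherianRing R] (I : Ideal R) (i : ℕ) (hfin : ∀ n : ℕ, Module.Finite R
      (((Ext R (ModuleCat.{0} R) i).obj (op (ModuleCat.of R (R ⧸ I ^ n)))).obj (ModuleCat.of R R))) :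
    Subsingleton ((localCohomology I i).obj (ModuleCat.of R R)) ↔
      ∀ n : ℕ, ∃ (m : ℕ) (h : n ≤ m), ((Ext R (ModuleCat.{0} R) i).map
        ((ringModIdeals (idealPowersDiagram I)).map (homOfLE h).op).op).app (ModuleCat.of R R) = 0 := by
  let F := diagram (idealPowersDiagram I) i ⋙ (evaluation _ _).obj (ModuleCat.of R R)
  have : ∀ j, Module.Finite R (F.obj j) := fun j => hfin j.unop.unop
  have e : (localCohomology I i).obj (ModuleCat.of R R) ≅ colimit F :=
    colimitObjIsoColimitCompEvaluation (diagram (idealPowersDiagram I) i) (ModuleCat.of R R)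
  rw [e.toLinearEquiv.toEquiv.subsingleton_congr, colim_crit F]
  constructor
  · intro h n
    obtain ⟨k, f, hf⟩ := h (op (op n))
    exact ⟨k.unop.unop, leOfHom f.unop.unop, hf⟩
  · intro h j
    obtain ⟨m, hm, h0⟩ := h j.unop.unop
    exact ⟨op (op m), (homOfLE hm).op.op, h0⟩
end partC
section partD
open Opposite Limits localCohomology
variable {R R' : Type} [CommRing R] [CommRing R']

lemma quot_sq (f : R →+* R') (I : Ideal R) {n m : ℕ} (h : n ≤ m) :
    ∃ (e : (ringModIdeals (idealPowersDiagram (I.map f))).obj (op m) ≅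
        (ModuleCat.extendScalars.{0,0,0} f).obj ((ringModIdeals (idealPowersDiagram I)).obj (op m)))
      (e' : (ringModIdeals (idealPowersDiagram (I.map f))).obj (op n) ≅
        (ModuleCat.extendScalars.{0,0,0} f).obj ((ringModIdeals (idealPowersDiagram I)).obj (op n))),
      (ringModIdeals (idealPowersDiagram (I.map f))).map (homOfLE h).op ≫ e'.hom =
        e.hom ≫ (ModuleCat.extendScalars.{0,0,0} f).map
          ((ringModIdeals (idealPowersDiagram I)).map (homOfLE h).op) := by
  let _ : Algebra R R' := f.toAlgebra
  let e : ∀ n : ℕ, (ringModIdeals (idealPowersDiagram (I.map f))).obj (op n) ≅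
      (ModuleCat.extendScalars.{0,0,0} f).obj ((ringModIdeals (idealPowersDiagram I)).obj (op n)) :=
    fun n =>
    LinearEquiv.toModuleIso (X₁ := R' ⧸ (I.map f) ^ n) (Submodule.quotEquivOfEq _ _ (Ideal.map_pow _ I n).symm ≪≫ₗ
      (Algebra.TensorProduct.quotIdealMapEquivTensorQuot R' (I ^ n)).toLinearEquiv)
  refine ⟨e m, e n, ?_⟩
  refine ModuleCat.hom_ext (LinearMap.ext fun x => ?_)
  obtain ⟨x, rfl⟩ := Ideal.Quotient.mk_surjective x
  rfl

variable [Algebra R R']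

lemma ff_restrict [h : Module.FaithfullyFlat R R'] :
    Module.FaithfullyFlat R
      ((ModuleCat.restrictScalars (algebraMap R R')).obj (ModuleCat.of R' R')) := by
  let e : R' ≃ₗ[R] ((ModuleCat.restrictScalars (algebraMap R R')).obj (ModuleCat.of R' R')) :=
    { toFun := fun x => x
      invFun := fun x => x
      left_inv := fun _ => rfl
      right_inv := fun _ => rfl
      map_add' := fun _ _ => rfl
      map_smul' := fun r x => Algebra.smul_def r x }
  exact Module.FaithfullyFlat.of_linearEquiv _ _ e.symm

lemma hom_crit_cat {P0 P1 Q1 Q2 : ModuleCat.{0} R}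
    [Module.Finite R P0] [Module.Projective R P0] [Module.Finite R P1] [Module.Projective R P1]
    [Module.Finite R Q1] [Module.Projective R Q1] [Module.Finite R Q2] [Module.Projective R Q2]
    (Y : ModuleCat.{0} R) [Module.FaithfullyFlat R Y]
    (d : Q2 ⟶ Q1) (ψ : P1 ⟶ Q1) (e : P1 ⟶ P0) :
    (∀ z : Q1 ⟶ ModuleCat.of R R, d ≫ z = 0 → ∃ w : P0 ⟶ ModuleCat.of R R, e ≫ w = ψ ≫ z) ↔
    (∀ z : Q1 ⟶ Y, d ≫ z = 0 → ∃ w : P0 ⟶ Y, e ≫ w = ψ ≫ z) := by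
  have key : ∀ Z : ModuleCat.{0} R,
      (∀ z : Q1 ⟶ Z, d ≫ z = 0 → ∃ w : P0 ⟶ Z, e ≫ w = ψ ≫ z) ↔
      (∀ z : Q1 →ₗ[R] Z, z ∘ₗ d.hom = 0 → ∃ w : P0 →ₗ[R] Z, w ∘ₗ e.hom = z ∘ₗ ψ.hom) := by
    intro Z
    constructor
    · intro h z hz
      obtain ⟨w, hw⟩ := h (ModuleCat.ofHom z) (ModuleCat.hom_ext hz)
      exact ⟨w.hom, congr(($hw).hom)⟩
    · intro h z hz
      obtain ⟨w, hw⟩ := h z.hom congr(($hz).hom)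
      exact ⟨ModuleCat.ofHom w, ModuleCat.hom_ext hw⟩
  rw [key, key]
  exact hom_crit Y d.hom ψ.hom e.hom

lemma adj_crit {P0 P1 Q1 Q2 : ModuleCat.{0} R} (Y : ModuleCat.{0} R')
    (d : Q2 ⟶ Q1) (ψ : P1 ⟶ Q1) (e : P1 ⟶ P0) :
    (∀ z : Q1 ⟶ (ModuleCat.restrictScalars (algebraMap R R')).obj Y, d ≫ z = 0 →
      ∃ w : P0 ⟶ (ModuleCat.restrictScalars (algebraMap R R')).obj Y, e ≫ w = ψ ≫ z) ↔
    (∀ z : (ModuleCat.extendScalars (algebraMap R R')).obj Q1 ⟶ Y,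
      (ModuleCat.extendScalars (algebraMap R R')).map d ≫ z = 0 →
      ∃ w : (ModuleCat.extendScalars (algebraMap R R')).obj P0 ⟶ Y,
        (ModuleCat.extendScalars (algebraMap R R')).map e ≫ w =
          (ModuleCat.extendScalars (algebraMap R R')).map ψ ≫ z) := by
  let adj := ModuleCat.extendRestrictScalarsAdj.{0} (algebraMap R R')
  have hz : ∀ X : ModuleCat.{0} R, adj.homEquiv X Y 0 = 0 := by
    intro X
    rw [Adjunction.homEquiv_unit, Functor.map_zero, comp_zero]
  rw [(adj.homEquiv Q1 Y).surjective.forall]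
  refine forall_congr' fun z => ?_
  rw [(adj.homEquiv P0 Y).surjective.exists, ← adj.homEquiv_naturality_left, ← hz,
    (adj.homEquiv _ _).apply_eq_iff_eq]
  refine imp_congr Iff.rfl (exists_congr fun w => ?_)
  rw [← adj.homEquiv_naturality_left, ← adj.homEquiv_naturality_left,
    (adj.homEquiv _ _).apply_eq_iff_eq]

lemma comm_aux {C : Type*} [Category C] {A B X Y : C} (a : A ⟶ B) (b : B ⟶ X) (u : X ⟶ X)
    (c : A ⟶ Y) (v : Y ⟶ Y) (d : Y ⟶ X) (hu : u = 𝟙 _) (hv : v = 𝟙 _) (h : a ≫ b = c ≫ d) :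
    a ≫ b ≫ u = (c ≫ v) ≫ d := by
  subst hu hv
  simpa using h

lemma base_change_crit [Module.FaithfullyFlat R R']
    {M N : ModuleCat.{0} R} (φ : M ⟶ N) (P : ProjectiveResolution M) (Q : ProjectiveResolution N)
    (hP : ∀ n, Module.Finite R (P.complex.X n)) (hQ : ∀ n, Module.Finite R (Q.complex.X n))
    [(ModuleCat.extendScalars.{0,0,0} (algebraMap R R')).Additive]
    [(ModuleCat.extendScalars.{0,0,0} (algebraMap R R')).PreservesHomology]
    [(ModuleCat.extendScalars.{0,0,0} (algebraMap R R')).PreservesProjectiveObjects] (i : ℕ) :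
    ((Ext R (ModuleCat.{0} R) i).map φ.op).app (ModuleCat.of R R) = 0 ↔
    ((Ext R' (ModuleCat.{0} R') i).map
      ((ModuleCat.extendScalars.{0,0,0} (algebraMap R R')).map φ).op).app (ModuleCat.of R' R') = 0 := by
  let G := ModuleCat.extendScalars.{0,0,0} (algebraMap R R')
  have hp : ∀ n, Module.Projective R (P.complex.X n) := fun n =>
    (IsProjective.iff_projective _).2 (P.projective n)
  have hq : ∀ n, Module.Projective R (Q.complex.X n) := fun n =>
    (IsProjective.iff_projective _).2 (Q.projective n)
  have := ff_restrict (R := R) (R' := R')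
  let ψ := ProjectiveResolution.lift φ P Q
  have hψ : ψ.f 0 ≫ Q.π.f 0 = P.π.f 0 ≫ φ := ProjectiveResolution.lift_commutes_zero φ P Q
  rw [ext_crit φ P Q ψ hψ]
  rw [ext_crit (G.map φ) (G.mapProjectiveResolution P) (G.mapProjectiveResolution Q)
    ((G.mapHomologicalComplex _).map ψ) ?_]
  · rw [hom_crit_cat ((ModuleCat.restrictScalars (algebraMap R R')).obj (ModuleCat.of R' R')),
      adj_crit]
    rfl
  · have := congr(G.map $hψ)
    simp only [Functor.map_comp] at this
    simp only [Functor.mapProjectiveResolution_π, HomologicalComplex.comp_f,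
      Functor.mapHomologicalComplex_map_f, Functor.mapHomologicalComplex_obj_X]
    simp only [HomologicalComplex.singleMapHomologicalComplex_hom_app_self]
    have key : ∀ N : ModuleCat.{0} R,
        G.map (HomologicalComplex.singleObjXSelf (ComplexShape.down ℕ) 0 N).hom ≫
          (HomologicalComplex.singleObjXSelf (ComplexShape.down ℕ) 0 (G.obj N)).inv =
            𝟙 (G.obj N) := by
      intro N
      refine Eq.trans (b := G.map (𝟙 N) ≫ 𝟙 (G.obj N)) rfl ?_
      simp
    exact comm_aux _ _ _ _ _ _ (key N) (key M) (this.trans (G.map_comp _ _))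

lemma ext_finite' [IsNoetherianRing R] (I : Ideal R) (i : ℕ) (n : ℕ) : Module.Finite R
    (((Ext R (ModuleCat.{0} R) i).obj (op (ModuleCat.of R (R ⧸ I ^ n)))).obj (ModuleCat.of R R)) := by
  obtain ⟨P, hP⟩ := exists_fg_res (R := R) (R ⧸ I ^ n)
  exact ext_finite P hP _ i

lemma main_iff [IsNoetherianRing R] [IsNoetherianRing R'] [hff : Module.FaithfullyFlat R R']
    (I : Ideal R) (i : ℕ) :
    Subsingleton ((localCohomology I i).obj (ModuleCat.of R R)) ↔
    Subsingleton ((localCohomology (I.map (algebraMap R R')) i).obj (ModuleCat.of R' R')) := by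
  let G := ModuleCat.extendScalars.{0,0,0} (algebraMap R R')
  let adj := ModuleCat.extendRestrictScalarsAdj.{0} (algebraMap R R')
  have hfl : (algebraMap R R').Flat := (RingHom.flat_algebraMap_iff).2 inferInstance
  have : PreservesFiniteLimits G := ModuleCat.preservesFiniteLimits_extendScalars_of_flat hfl
  have : PreservesColimitsOfSize.{0,0} G := adj.leftAdjoint_preservesColimits
  have : PreservesFiniteColimits G := PreservesColimitsOfSize.preservesFiniteColimits G
  have : G.Additive := Functor.additive_of_preserves_binary_products G
  have : G.PreservesProjectiveObjects :=
    Functor.preservesProjectiveObjects_of_adjunction_of_preservesEpimorphisms adj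
  have : G.PreservesHomology := inferInstance
  rw [lc_crit I i (ext_finite' I i), lc_crit _ i (ext_finite' _ i)]
  refine forall_congr' fun n => exists_congr fun m => exists_congr fun h => ?_
  obtain ⟨P, hP⟩ := exists_fg_res (R := R) (R ⧸ I ^ m)
  obtain ⟨Q, hQ⟩ := exists_fg_res (R := R) (R ⧸ I ^ n)
  rw [base_change_crit (R' := R') ((ringModIdeals (idealPowersDiagram I)).map (homOfLE h).op)
    P Q hP hQ i]
  have ee := quot_sq (algebraMap R R') I h
  obtain ⟨e, e', sq⟩ := ee
  let T := (Ext R' (ModuleCat.{0} R') i).flip.obj (ModuleCat.of R' R')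
  refine (zero_iff_of_iso_sq _ _ (T.mapIso e'.op) (T.mapIso e.op) ?_)
  have := congr(T.map ($sq).op)
  simp only [op_comp, Functor.map_comp] at this
  exact this.symm

end partD

/-- Proposition 3.6: if `R → R'` is a faithfully flat homomorphism of Noetherian rings
(i.e. `R'` is flat over `R` and `Spec R' → Spec R` is surjective), then `R` is relative
Cohen-Macaulay w.r.t. `𝔞` iff `R'` is relative Cohen-Macaulay w.r.t. `𝔞R'`. -/
theorem stmt19 (R R' : Type) [CommRing R] [CommRing R']
    [IsNoetherianRing R] [IsNoetherianRing R'] [Algebra R R']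
    (hflat : Module.Flat R R')
    (hsurj : ∀ p : Ideal R, p.IsPrime →
      ∃ q : Ideal R', q.IsPrime ∧ q.comap (algebraMap R R') = p)
    (𝔞 : Ideal R) (h𝔞 : 𝔞 ≠ ⊤) :
    IsRelCM 𝔞 R ↔ IsRelCM (𝔞.map (algebraMap R R')) R' := by
  have hff : Module.FaithfullyFlat R R' := by
    refine Module.FaithfullyFlat.of_comap_surjective fun p => ?_
    obtain ⟨q, hq, hqp⟩ := hsurj p.asIdeal p.isPrime
    exact ⟨⟨q, hq⟩, PrimeSpectrum.ext hqp⟩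
  unfold IsRelCM
  refine exists_congr fun c => forall_congr' fun i => ?_
  rw [← not_subsingleton_iff_nontrivial, ← not_subsingleton_iff_nontrivial,
    main_iff (R' := R') 𝔞 i]
end
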